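/- arXiv:2410.13735 — 6 statements merged into one kernel-verified Lean document; each statement's English description precedes it below -/
import Mathlib

section
/- Let n ≥ 1, K ≥ 1 be integers and α ∈ (0,1). Let E_1, ..., E_{n+1} be exchangeable random vectors taking values in ℝ^K, and let T : (ℝ^K)^{n+1} → ℝ^K be a measurable permutation-symmetric function such that for every input (e_1,...,e_{n+1}) ∈ (ℝ^K)^{n+1}, the number of indices i ∈ {1,...,n+1} with e_i ≻ T(e_1,...,e_{n+1}) is at most ⌊α(n+1)⌋. Then P(∃ r ∈ {1,...,K} such that the r-th coordinate of E_{n+1} is ≤ the r-th coordinate of T(E_1,...,E_{n+1})) ≥ 1 − α. -/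
open MeasureTheory

open scoped Classical in
/-- Theorem 1 (Validity of GCP-VCR): if the permutation-symmetric threshold map `T`
has at most `⌊α(n+1)⌋` strict dominators among its inputs, then the event that some
coordinate of the test score `E (n+1)` is below the corresponding coordinate of the
threshold has probability at least `1 - α`. -/
theorem gcp_vcr_validity
    (n K : ℕ) (hn : 1 ≤ n) (hK : 1 ≤ K)
    (α : ℝ) (hα : α ∈ Set.Ioo (0 : ℝ) 1)
    {Ω : Type*} [MeasurableSpace Ω] (P : Measure Ω) [IsProbabilityMeasure P]
    (E : Fin (n + 1) → Ω → (Fin K → ℝ))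
    (hE : ∀ i, Measurable (E i))
    (hexch : ∀ σ : Equiv.Perm (Fin (n + 1)),
      Measure.map (fun ω => fun i => E (σ i) ω) P
        = Measure.map (fun ω => fun i => E i ω) P)
    (T : (Fin (n + 1) → Fin K → ℝ) → (Fin K → ℝ))
    (hT : Measurable T)
    (hsymm : ∀ (σ : Equiv.Perm (Fin (n + 1))) (e : Fin (n + 1) → Fin K → ℝ),
      T (fun i => e (σ i)) = T e)
    (hcount : ∀ e : Fin (n + 1) → Fin K → ℝ,
      (Finset.univ.filter (fun i : Fin (n + 1) => ∀ r, T e r < e i r)).card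
        ≤ ⌊α * (n + 1)⌋₊) :
    ENNReal.ofReal (1 - α)
      ≤ P {ω | ∃ r : Fin K, E (Fin.last n) ω r ≤ T (fun i => E i ω) r} := by
  have hEm : Measurable (fun ω => fun i => E i ω) := measurable_pi_lambda _ hE
  have hA : ∀ i : Fin (n + 1), MeasurableSet
      {e : Fin (n + 1) → Fin K → ℝ | ∀ r, T e r < e i r} := by
    intro i
    rw [Set.setOf_forall]
    refine MeasurableSet.iInter fun r => measurableSet_lt ?_ ?_
    · exact (measurable_pi_apply r).comp hT
    · exact (measurable_pi_apply r).comp (measurable_pi_apply i)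
  have hB : ∀ i : Fin (n + 1), MeasurableSet
      {ω | ∀ r, T (fun j => E j ω) r < E i ω r} := fun i => hEm (hA i)
  have heq : ∀ i : Fin (n + 1), P {ω | ∀ r, T (fun j => E j ω) r < E i ω r}
      = P {ω | ∀ r, T (fun j => E j ω) r < E (Fin.last n) ω r} := by
    intro i
    have hσm : Measurable (fun ω => fun j => E (Equiv.swap i (Fin.last n) j) ω) :=
      measurable_pi_lambda _ fun j => hE _
    have h := congrArg (fun m => m {e : Fin (n + 1) → Fin K → ℝ | ∀ r, T e r < e (Fin.last n) r})
      (hexch (Equiv.swap i (Fin.last n)))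
    simp only [Measure.map_apply hσm (hA _), Measure.map_apply hEm (hA _)] at h
    have h2 : ∀ ω, T (fun j => E (Equiv.swap i (Fin.last n) j) ω) = T (fun j => E j ω) :=
      fun ω => hsymm (Equiv.swap i (Fin.last n)) (fun j => E j ω)
    simpa only [Set.preimage_setOf_eq, h2, Equiv.swap_apply_right] using h
  have hsum : ∑ i : Fin (n + 1), P {ω | ∀ r, T (fun j => E j ω) r < E i ω r}
      ≤ (⌊α * (n + 1)⌋₊ : ENNReal) := by
    calc ∑ i : Fin (n + 1), P {ω | ∀ r, T (fun j => E j ω) r < E i ω r}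
        = ∑ i : Fin (n + 1), ∫⁻ ω, Set.indicator
            {ω | ∀ r, T (fun j => E j ω) r < E i ω r} 1 ω ∂P := by
          refine Finset.sum_congr rfl fun i _ => (lintegral_indicator_one (hB i)).symm
      _ = ∫⁻ ω, ∑ i : Fin (n + 1), Set.indicator
            {ω | ∀ r, T (fun j => E j ω) r < E i ω r} 1 ω ∂P :=
          (lintegral_finsetSum _ fun i _ => measurable_one.indicator (hB i)).symm
      _ ≤ ∫⁻ _, (⌊α * (n + 1)⌋₊ : ENNReal) ∂P := by
          refine lintegral_mono fun ω => ?_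
          have := hcount (fun j => E j ω)
          simp only [Set.indicator_apply, Set.mem_setOf_eq, Pi.one_apply, Finset.sum_boole]
          exact_mod_cast this
      _ = _ := by simp
  simp only [heq, Finset.sum_const, Finset.card_univ, Fintype.card_fin, nsmul_eq_mul] at hsum
  have hcompl : {ω | ∃ r : Fin K, E (Fin.last n) ω r ≤ T (fun i => E i ω) r}
      = {ω | ∀ r, T (fun j => E j ω) r < E (Fin.last n) ω r}ᶜ := by
    ext ω; simp
  rw [hcompl, prob_compl_eq_one_sub (hB _), ENNReal.ofReal_sub _ hα.1.le, ENNReal.ofReal_one]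
  refine tsub_le_tsub_left ?_ _
  have hn0 : (0 : ℝ) < (n : ℝ) + 1 := by positivity
  have hfl : (⌊α * (n + 1)⌋₊ : ENNReal) ≤ ((n + 1 : ℕ) : ENNReal) * ENNReal.ofReal α := by
    rw [← ENNReal.ofReal_natCast, ← ENNReal.ofReal_natCast (n + 1),
      ← ENNReal.ofReal_mul (by positivity)]
    refine ENNReal.ofReal_le_ofReal ?_
    have := Nat.floor_le (mul_nonneg hα.1.le hn0.le)
    push_cast
    linarith
  exact (ENNReal.mul_le_mul_iff_right (by simp) (ENNReal.natCast_ne_top _)).1 (hsum.trans hfl)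
end

section
/- Let n ≥ 1, K ≥ 1 be integers and let k be a natural number. Let E_1, ..., E_{n+1} be exchangeable random vectors taking values in ℝ^K, and let T : (ℝ^K)^{n+1} → ℝ^K be a measurable permutation-symmetric function such that for every input (e_1,...,e_{n+1}) ∈ (ℝ^K)^{n+1}, the number of indices i ∈ {1,...,n+1} with e_i ≻ T(e_1,...,e_{n+1}) is at most k. Then P(E_{n+1} ≻ T(E_1,...,E_{n+1})) ≤ k/(n+1). -/
open MeasureTheory

open scoped Classical in
/-- Miscoverage bound: if at most `k` of the `n+1` score vectors strictly dominate
the symmetric threshold `T`, then the test vector strictly dominates the threshold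
with probability at most `k/(n+1)`. -/
theorem gcp_vcr_miscoverage_bound
    (n K : ℕ) (hn : 1 ≤ n) (hK : 1 ≤ K) (k : ℕ)
    {Ω : Type*} [MeasurableSpace Ω] (P : Measure Ω) [IsProbabilityMeasure P]
    (E : Fin (n + 1) → Ω → (Fin K → ℝ))
    (hE : ∀ i, Measurable (E i))
    (hexch : ∀ σ : Equiv.Perm (Fin (n + 1)),
      Measure.map (fun ω => fun i => E (σ i) ω) P
        = Measure.map (fun ω => fun i => E i ω) P)
    (T : (Fin (n + 1) → Fin K → ℝ) → (Fin K → ℝ))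
    (hT : Measurable T)
    (hsymm : ∀ (σ : Equiv.Perm (Fin (n + 1))) (e : Fin (n + 1) → Fin K → ℝ),
      T (fun i => e (σ i)) = T e)
    (hcount : ∀ e : Fin (n + 1) → Fin K → ℝ,
      (Finset.univ.filter (fun i : Fin (n + 1) => ∀ r, T e r < e i r)).card ≤ k) :
    P {ω | ∀ r : Fin K, T (fun i => E i ω) r < E (Fin.last n) ω r}
      ≤ (k : ENNReal) / (n + 1) := by
  have hA : ∀ i, MeasurableSet {e : Fin (n + 1) → Fin K → ℝ | ∀ r, T e r < e i r} := by
    intro i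
    rw [Set.setOf_forall]
    refine MeasurableSet.iInter fun r => measurableSet_lt ?_ ?_
    · exact (measurable_pi_apply r).comp hT
    · exact (measurable_pi_apply r).comp (measurable_pi_apply i)
  have hX : ∀ σ : Equiv.Perm (Fin (n + 1)), Measurable (fun ω => fun i => E (σ i) ω) :=
    fun σ => measurable_pi_lambda _ fun i => hE (σ i)
  have hX1 : Measurable (fun ω => fun i => E i ω) := measurable_pi_lambda _ hE
  have hB : ∀ i, MeasurableSet {ω | ∀ r : Fin K, T (fun j => E j ω) r < E i ω r} :=
    fun i => hX1 (hA i)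
  have heq : ∀ i, P {ω | ∀ r : Fin K, T (fun j => E j ω) r < E i ω r}
      = P {ω | ∀ r : Fin K, T (fun j => E j ω) r < E (Fin.last n) ω r} := by
    intro i
    have h := congrArg (fun m => m {e : Fin (n + 1) → Fin K → ℝ | ∀ r, T e r < e (Fin.last n) r})
      (hexch (Equiv.swap i (Fin.last n)))
    simp only [Measure.map_apply (hX _) (hA _), Measure.map_apply hX1 (hA _)] at h
    have h2 : ∀ ω, T (fun j => E (Equiv.swap i (Fin.last n) j) ω) = T (fun j => E j ω) :=
      fun ω => hsymm (Equiv.swap i (Fin.last n)) (fun j => E j ω)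
    simpa only [Set.preimage_setOf_eq, h2, Equiv.swap_apply_right] using h
  have hsum : ∑ i : Fin (n + 1), P {ω | ∀ r : Fin K, T (fun j => E j ω) r < E i ω r} ≤ k := by
    calc ∑ i : Fin (n + 1), P {ω | ∀ r : Fin K, T (fun j => E j ω) r < E i ω r}
        = ∑ i : Fin (n + 1), ∫⁻ ω, Set.indicator
            {ω | ∀ r : Fin K, T (fun j => E j ω) r < E i ω r} 1 ω ∂P := by
          refine Finset.sum_congr rfl fun i _ => (lintegral_indicator_one (hB i)).symm
      _ = ∫⁻ ω, ∑ i : Fin (n + 1), Set.indicator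
            {ω | ∀ r : Fin K, T (fun j => E j ω) r < E i ω r} 1 ω ∂P :=
          (lintegral_finsetSum _ fun i _ => measurable_one.indicator (hB i)).symm
      _ ≤ ∫⁻ _, (k : ENNReal) ∂P := by
          refine lintegral_mono fun ω => ?_
          have := hcount (fun j => E j ω)
          simp only [Set.indicator_apply, Set.mem_setOf_eq, Pi.one_apply, Finset.sum_boole]
          exact_mod_cast this
      _ = k := by simp
  simp only [heq, Finset.sum_const, Finset.card_univ, Fintype.card_fin, nsmul_eq_mul] at hsum
  rw [ENNReal.le_div_iff_mul_le (Or.inl (by positivity)) (Or.inl (by finiteness)), mul_comm]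
  exact_mod_cast hsum
end

section
/- Let n ≥ 1, K ≥ 1 be integers, let β_1, ..., β_K ∈ (0,1), let e_1, ..., e_n ∈ ℝ^K and t ∈ ℝ^K. For each coordinate r ∈ {1,...,K}, set k_r = ⌈(1−β_r)(n+1)⌉, let q_r be the k_r-th smallest element of the multiset {e_{1,r}, ..., e_{n,r}, +∞} (viewed in ℝ ∪ {+∞}), and let q'_r be the k_r-th smallest element of the multiset {e_{1,r}, ..., e_{n,r}, t_r}. Then (t_r > q_r for every r ∈ {1,...,K}) if and only if (t_r > q'_r for every r ∈ {1,...,K}). -/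
/-- The `k`-th smallest element (1-indexed) of a multiset of extended reals. -/
noncomputable def kthSmallest (s : Multiset EReal) (k : ℕ) : EReal :=
  (s.sort (· ≤ ·)).getD (k - 1) 0

theorem getD_lt_iff_countP (x : EReal) (l : List EReal) (h : l.Pairwise (· ≤ ·)) (j : ℕ)
    (hj : j < l.length) : l.getD j 0 < x ↔ j < l.countP (fun y => decide (y < x)) := by
  induction l generalizing j with
  | nil => simp at hj
  | cons a l ih =>
    rw [List.pairwise_cons] at h
    obtain ⟨h1, h2⟩ := h
    by_cases ha : a < x
    · rw [List.countP_cons_of_pos (by simpa using ha)]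
      cases j with
      | zero => simpa using ha
      | succ j =>
        rw [List.getD_cons_succ, ih h2 j (by simpa using hj)]
        omega
    · have h0 : (a :: l).countP (fun y => decide (y < x)) = 0 := by
        rw [List.countP_eq_zero]
        intro b hb
        rcases List.mem_cons.1 hb with rfl | hb
        · simpa using ha
        · simpa using (not_lt.1 ha).trans (h1 b hb)
      rw [h0]
      rw [List.countP_eq_zero] at h0
      rw [List.getD_eq_getElem _ _ hj]
      have := h0 _ (List.getElem_mem hj)
      simpa using this

theorem kthSmallest_lt_iff (x : EReal) (s : Multiset EReal) (k : ℕ)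
    (hk : k - 1 < s.card) :
    kthSmallest s k < x ↔ k - 1 < s.countP (fun y => y < x) := by
  unfold kthSmallest
  rw [getD_lt_iff_countP x _ (Multiset.pairwise_sort s _) _ (by simpa using hk)]
  conv_rhs => rw [← Multiset.sort_eq s (· ≤ ·)]
  rw [Multiset.coe_countP]

/-- Vector quantile swap (equation (7)): the test vector `t` strictly dominates, in
every coordinate `r`, the `⌈(1−β_r)(n+1)⌉`-th smallest of the calibration scores
augmented by `+∞` iff it strictly dominates the corresponding quantiles computed
with `t_r` in place of `+∞`. -/
theorem vector_quantile_swap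
    (n K : ℕ) (hn : 1 ≤ n) (hK : 1 ≤ K)
    (β : Fin K → ℝ) (hβ : ∀ r, β r ∈ Set.Ioo (0 : ℝ) 1)
    (e : Fin n → Fin K → ℝ) (t : Fin K → ℝ) :
    ((∀ r : Fin K,
        kthSmallest
          ((⊤ : EReal) ::ₘ Finset.univ.val.map (fun i : Fin n => ((e i r : ℝ) : EReal)))
          ⌈(1 - β r) * (n + 1)⌉₊ < (t r : EReal))
      ↔ (∀ r : Fin K,
        kthSmallest
          (((t r : ℝ) : EReal) ::ₘ Finset.univ.val.map (fun i : Fin n => ((e i r : ℝ) : EReal)))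
          ⌈(1 - β r) * (n + 1)⌉₊ < (t r : EReal))) := by
  refine forall_congr' fun r => ?_
  have hk : ⌈(1 - β r) * (n + 1)⌉₊ ≤ n + 1 := by
    rw [Nat.ceil_le]
    push_cast
    have := (hβ r).1
    have hn0 : (0 : ℝ) ≤ n := Nat.cast_nonneg n
    nlinarith
  rw [kthSmallest_lt_iff _ _ _ (by rw [Multiset.card_cons, Multiset.card_map, Finset.card_val, Finset.card_univ, Fintype.card_fin]; omega), kthSmallest_lt_iff _ _ _ (by rw [Multiset.card_cons, Multiset.card_map, Finset.card_val, Finset.card_univ, Fintype.card_fin]; omega),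
    Multiset.countP_cons_of_neg _ (by simp), Multiset.countP_cons_of_neg _ (by simp)]
end

section
/- Let n ≥ 1, K ≥ 1 be integers and α ∈ (0,1). Let E_1, ..., E_{n+1} be exchangeable random vectors taking values in ℝ^K, and let T : (ℝ^K)^{n+1} → ℝ^K be a measurable permutation-symmetric function such that for every input (e_1,...,e_{n+1}) ∈ (ℝ^K)^{n+1}, (1/(n+1)) · #{ i ∈ {1,...,n+1} : ∃ r ∈ {1,...,K} with e_{i,r} ≤ T(e_1,...,e_{n+1})_r } ≥ 1 − α. Then P(∃ r ∈ {1,...,K} such that the r-th coordinate of E_{n+1} is ≤ the r-th coordinate of T(E_1,...,E_{n+1})) ≥ 1 − α. -/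
open MeasureTheory

open scoped Classical in
/-- Corollary 1 (Validity of Approximated Solution): any permutation-symmetric
threshold map `T` satisfying the empirical coverage constraint for every realization
yields marginal coverage at least `1 − α`. -/
theorem gcp_vcr_approx_validity
    (n K : ℕ) (hn : 1 ≤ n) (hK : 1 ≤ K)
    (α : ℝ) (hα : α ∈ Set.Ioo (0 : ℝ) 1)
    {Ω : Type*} [MeasurableSpace Ω] (P : Measure Ω) [IsProbabilityMeasure P]
    (E : Fin (n + 1) → Ω → (Fin K → ℝ))
    (hE : ∀ i, Measurable (E i))
    (hexch : ∀ σ : Equiv.Perm (Fin (n + 1)),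
      Measure.map (fun ω => fun i => E (σ i) ω) P
        = Measure.map (fun ω => fun i => E i ω) P)
    (T : (Fin (n + 1) → Fin K → ℝ) → (Fin K → ℝ))
    (hT : Measurable T)
    (hsymm : ∀ (σ : Equiv.Perm (Fin (n + 1))) (e : Fin (n + 1) → Fin K → ℝ),
      T (fun i => e (σ i)) = T e)
    (hcover : ∀ e : Fin (n + 1) → Fin K → ℝ,
      (1 / (n + 1 : ℝ)) *
          ((Finset.univ.filter
            (fun i : Fin (n + 1) => ∃ r : Fin K, e i r ≤ T e r)).card : ℝ)
        ≥ 1 - α) :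
    ENNReal.ofReal (1 - α)
      ≤ P {ω | ∃ r : Fin K, E (Fin.last n) ω r ≤ T (fun i => E i ω) r} := by
  set X : Ω → (Fin (n + 1) → Fin K → ℝ) := fun ω i => E i ω with hX
  have hXm : Measurable X := measurable_pi_lambda _ hE
  let A : Fin (n + 1) → Set (Fin (n + 1) → Fin K → ℝ) :=
    fun i => {e | ∃ r : Fin K, e i r ≤ T e r}
  have hA : ∀ i, MeasurableSet (A i) := by
    intro i
    have : A i = ⋃ r : Fin K, {e | e i r ≤ T e r} := by
      ext e; simp [A]
    rw [this]
    refine MeasurableSet.iUnion fun r => measurableSet_le ?_ ?_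
    · exact (measurable_pi_apply r).comp (measurable_pi_apply i)
    · exact (measurable_pi_apply r).comp hT
  have hPA : ∀ i, P (X ⁻¹' A i) = P (X ⁻¹' A (Fin.last n)) := by
    intro i
    have h := congrArg (fun m => m (A (Fin.last n))) (hexch (Equiv.swap i (Fin.last n)))
    rw [Measure.map_apply (measurable_pi_lambda _ fun j => hE _) (hA _),
      Measure.map_apply hXm (hA _)] at h
    rw [← h]
    congr 1
    ext ω
    have h2 := hsymm (Equiv.swap i (Fin.last n)) (X ω)
    simp only [hX] at h2
    simp [A, hX, h2]
  have hsum : ∑ i, P (X ⁻¹' A i) = ∫⁻ ω, ∑ i, (X ⁻¹' A i).indicator 1 ω ∂P := by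
    rw [lintegral_finsetSum]
    · refine Finset.sum_congr rfl fun i _ => ?_
      rw [lintegral_indicator_one (hXm (hA i))]
    · intro i _
      exact measurable_one.indicator (hXm (hA i))
  have hpos : (0 : ℝ) < (n : ℝ) + 1 := by positivity
  have hlow : ENNReal.ofReal ((n + 1) * (1 - α)) ≤ ∑ i, P (X ⁻¹' A i) := by
    rw [hsum]
    calc ENNReal.ofReal ((n + 1) * (1 - α))
        = ∫⁻ _, ENNReal.ofReal ((n + 1) * (1 - α)) ∂P := by simp
      _ ≤ _ := by
        refine lintegral_mono fun ω => ?_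
        have hc := hcover (X ω)
        have hs : ∑ i, (X ⁻¹' A i).indicator (1 : Ω → ENNReal) ω
            = ((Finset.univ.filter
              (fun i : Fin (n + 1) => ∃ r : Fin K, X ω i r ≤ T (X ω) r)).card : ENNReal) := by
          rw [Finset.card_filter]
          push_cast
          refine Finset.sum_congr rfl fun i _ => ?_
          simp [Set.indicator_apply, A]
        simp only [hs]
        rw [← ENNReal.ofReal_natCast]
        apply ENNReal.ofReal_le_ofReal
        rw [ge_iff_le, one_div, inv_mul_eq_div, le_div_iff₀ hpos] at hc
        linarith
  have hfin : ∑ i, P (X ⁻¹' A i) = ENNReal.ofReal (n + 1) * P (X ⁻¹' A (Fin.last n)) := by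
    rw [Finset.sum_congr rfl fun i _ => hPA i]
    have : ENNReal.ofReal ((n : ℝ) + 1) = (n : ENNReal) + 1 := by
      rw [ENNReal.ofReal_add (by positivity) (by norm_num)]; simp
    simp [this]
  rw [hfin, ENNReal.ofReal_mul hpos.le] at hlow
  exact (ENNReal.mul_le_mul_iff_right (by simpa using hpos) ENNReal.ofReal_ne_top).1 hlow
end

section
/- Let n ≥ 1 be an integer and α ∈ (0,1). Let S_1, ..., S_{n+1} be exchangeable real-valued random variables, set k = ⌈(1−α)(n+1)⌉, and let Q̂ be the k-th smallest element of the multiset {S_1, ..., S_n, +∞} (viewed in ℝ ∪ {+∞}). Then P(S_{n+1} ≤ Q̂) ≥ 1 − α. -/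
open MeasureTheory

lemma aux_kth (s : Multiset EReal) (k : ℕ) (hk1 : 1 ≤ k) (hk : k ≤ s.card) (a : EReal)
    (h : s.countP (· < a) < k) : a ≤ kthSmallest s k := by
  by_contra hlt
  push Not at hlt
  unfold kthSmallest at hlt
  have hlen : (s.sort (· ≤ ·)).length = s.card := Multiset.length_sort (· ≤ ·)
  have hs : ((s.sort (· ≤ ·) : List EReal) : Multiset EReal) = s := Multiset.sort_eq s (· ≤ ·)
  have hsorted : (s.sort (· ≤ ·)).Pairwise (· ≤ ·) := Multiset.pairwise_sort s (· ≤ ·)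
  rw [← hs, Multiset.coe_countP] at h
  generalize s.sort (· ≤ ·) = L at *
  have hkL : k - 1 < L.length := by omega
  rw [List.getD_eq_getElem _ _ hkL] at hlt
  have h1 : (L.take k).countP (· < a) = (L.take k).length := by
    rw [List.countP_eq_length]
    intro b hb
    obtain ⟨i, hi, rfl⟩ := List.mem_iff_getElem.1 hb
    rw [List.length_take] at hi
    rw [List.getElem_take]
    have : L[i] ≤ L[k-1] := by
      rcases Nat.lt_or_ge i (k-1) with h' | h'
      · exact List.pairwise_iff_getElem.1 hsorted i (k-1) (by omega) hkL h'
      · have : i = k - 1 := by omega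
        subst this; exact le_rfl
    simpa using this.trans_lt hlt
  have h2 : (L.take k).countP (· < a) ≤ L.countP (· < a) :=
    (List.take_sublist k L).countP_le
  rw [h1, List.length_take] at h2
  omega

lemma aux_count {m : ℕ} (x : Fin m → ℝ) (k : ℕ) (hk : k ≤ m) :
    k ≤ (Finset.univ.filter
      (fun i => (Finset.univ.filter (fun j => x j < x i)).card < k)).card := by
  by_cases hB : ∃ i, k ≤ (Finset.univ.filter (fun j => x j < x i)).card
  · have hne : (Finset.univ.filter
        (fun i => k ≤ (Finset.univ.filter (fun j => x j < x i)).card)).Nonempty := by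
      obtain ⟨i, hi⟩ := hB
      exact ⟨i, by simpa using hi⟩
    obtain ⟨i, hi, hmin⟩ := Finset.exists_min_image _ x hne
    simp only [Finset.mem_filter, Finset.mem_univ, true_and] at hi hmin
    refine hi.trans (Finset.card_le_card ?_)
    intro j hj
    simp only [Finset.mem_filter, Finset.mem_univ, true_and] at hj ⊢
    by_contra hc
    exact absurd (hmin j (not_lt.1 hc)) (not_le.2 hj)
  · push Not at hB
    rw [Finset.filter_true_of_mem (fun i _ => hB i)]
    simpa using hk

/-- Vectors whose `i`-th coordinate has fewer than `k` strictly smaller coordinates. -/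
def auxSet (m k : ℕ) (i : Fin m) : Set (Fin m → ℝ) :=
  {x | (Finset.univ.filter (fun j => x j < x i)).card < k}

lemma auxSet_meas (m k : ℕ) (i : Fin m) : MeasurableSet (auxSet m k i) := by
  have : Measurable (fun x : Fin m → ℝ => (Finset.univ.filter (fun j => x j < x i)).card) := by
    simp only [Finset.card_filter]
    refine Finset.measurable_sum _ (fun j _ => ?_)
    exact Measurable.ite (measurableSet_lt (measurable_pi_apply j) (measurable_pi_apply i))
      measurable_const measurable_const
  exact this (measurableSet_Iio (a := k))

lemma auxSet_perm (m k : ℕ) (i : Fin m) (σ : Equiv.Perm (Fin m)) (x : Fin m → ℝ) :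
    (fun j => x (σ j)) ∈ auxSet m k i ↔ x ∈ auxSet m k (σ i) := by
  unfold auxSet
  simp only [Set.mem_setOf_eq]
  rw [← Finset.card_map (σ.toEmbedding)]
  suffices h : (Finset.univ.filter (fun j => x (σ j) < x (σ i))).map σ.toEmbedding
    = Finset.univ.filter (fun j => x j < x (σ i)) by rw [h]
  ext j
  simp only [Finset.mem_map, Finset.mem_filter, Finset.mem_univ, true_and]
  constructor
  · rintro ⟨a, ha, rfl⟩; exact ha
  · intro h; exact ⟨σ.symm j, by simpa using h, by simp⟩

lemma aux_prob (m k : ℕ) (hk : k ≤ m) (μ : Measure (Fin m → ℝ)) [IsProbabilityMeasure μ] :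
    (k : ENNReal) ≤ ∑ i, μ (auxSet m k i) := by
  calc (k : ENNReal) = ∫⁻ _, (k : ENNReal) ∂μ := by simp
    _ ≤ ∫⁻ x, ∑ i, (auxSet m k i).indicator 1 x ∂μ := by
        refine lintegral_mono (fun x => ?_)
        have h := aux_count x k hk
        rw [Finset.card_filter] at h
        have h' : (k : ENNReal) ≤ ((∑ i, if (Finset.univ.filter (fun j => x j < x i)).card < k
          then 1 else 0 : ℕ) : ENNReal) := by exact_mod_cast h
        refine h'.trans (le_of_eq ?_)
        push_cast
        refine Finset.sum_congr rfl (fun i _ => ?_)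
        simp only [Set.indicator_apply, auxSet, Set.mem_setOf_eq, Pi.one_apply]
    _ = ∑ i, μ (auxSet m k i) := by
        rw [lintegral_finsetSum _ (fun i _ => measurable_one.indicator (auxSet_meas m k i))]
        exact Finset.sum_congr rfl (fun i _ => lintegral_indicator_one (auxSet_meas m k i))

/-- Scalar (K = 1) split conformal validity: the `⌈(1−α)(n+1)⌉`-th smallest of the
calibration scores augmented by `+∞` covers the test score with probability at least
`1 − α`. -/
theorem split_conformal_validity
    (n : ℕ) (hn : 1 ≤ n) (α : ℝ) (hα : α ∈ Set.Ioo (0 : ℝ) 1)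
    {Ω : Type*} [MeasurableSpace Ω] (P : Measure Ω) [IsProbabilityMeasure P]
    (S : Fin (n + 1) → Ω → ℝ)
    (hS : ∀ i, Measurable (S i))
    (hexch : ∀ σ : Equiv.Perm (Fin (n + 1)),
      Measure.map (fun ω => fun i => S (σ i) ω) P
        = Measure.map (fun ω => fun i => S i ω) P) :
    ENNReal.ofReal (1 - α)
      ≤ P {ω | (S (Fin.last n) ω : EReal)
          ≤ kthSmallest
              ((⊤ : EReal) ::ₘ
                Finset.univ.val.map (fun i : Fin n => ((S i.castSucc ω : ℝ) : EReal)))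
              ⌈(1 - α) * (n + 1)⌉₊} := by
  obtain ⟨h0, h1⟩ := hα
  set k := ⌈(1 - α) * (n + 1)⌉₊ with hkdef
  have hn0 : (0 : ℝ) < n + 1 := by positivity
  have hk1 : 1 ≤ k := Nat.ceil_pos.2 (mul_pos (by linarith) hn0)
  have hkn : k ≤ n + 1 := by
    refine Nat.ceil_le.2 ?_
    push_cast
    nlinarith
  have hmeas : Measurable (fun ω => fun i => S i ω) := measurable_pi_lambda _ hS
  set μ := Measure.map (fun ω => fun i => S i ω) P with hμ
  haveI : IsProbabilityMeasure μ := Measure.isProbabilityMeasure_map hmeas.aemeasurable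
  have heq : ∀ i, μ (auxSet (n+1) k i) = μ (auxSet (n+1) k (Fin.last n)) := by
    intro i
    have hσ := hexch (Equiv.swap i (Fin.last n))
    have hm' : Measurable (fun ω => fun j => S (Equiv.swap i (Fin.last n) j) ω) :=
      measurable_pi_lambda _ (fun j => hS _)
    conv_lhs => rw [← hσ]
    rw [Measure.map_apply hm' (auxSet_meas _ _ _), hμ,
      Measure.map_apply hmeas (auxSet_meas _ _ _)]
    congr 1
    ext ω
    have := auxSet_perm (n+1) k i (Equiv.swap i (Fin.last n)) (fun j => S j ω)
    rw [Equiv.swap_apply_left] at this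
    exact this
  have hsum := aux_prob (n+1) k hkn μ
  simp only [heq, Finset.sum_const, Finset.card_univ, Fintype.card_fin, nsmul_eq_mul] at hsum
  have hle : ENNReal.ofReal (1 - α) ≤ μ (auxSet (n+1) k (Fin.last n)) := by
    have hc : (1 - α) * (n + 1) ≤ k := Nat.le_ceil _
    have h2 : ENNReal.ofReal (1 - α) * ((n + 1 : ℕ) : ENNReal) ≤ k := by
      rw [← ENNReal.ofReal_natCast (n+1), ← ENNReal.ofReal_natCast k,
        ← ENNReal.ofReal_mul (by linarith)]
      exact ENNReal.ofReal_le_ofReal (by push_cast; exact hc)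
    have h3 := h2.trans hsum
    rw [mul_comm] at h3
    exact (ENNReal.mul_le_mul_iff_right (by simp) (ENNReal.natCast_ne_top _)).1 h3
  refine hle.trans ?_
  rw [hμ, Measure.map_apply hmeas (auxSet_meas _ _ _)]
  refine measure_mono (fun ω hω => ?_)
  refine aux_kth _ k hk1 (by simpa using hkn) _ ?_
  refine lt_of_le_of_lt ?_ (show (Finset.univ.filter
    (fun j => S j ω < S (Fin.last n) ω)).card < k from hω)
  rw [Multiset.countP_cons_of_neg _ (by simp), Multiset.countP_map]
  simp only [EReal.coe_lt_coe_iff]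
  rw [← Finset.filter_val, Finset.card_val, ← Finset.card_map Fin.castSuccEmb]
  refine Finset.card_le_card ?_
  intro j hj
  simp only [Finset.mem_map, Finset.mem_filter, Finset.mem_univ, true_and] at hj ⊢
  obtain ⟨a, ha, rfl⟩ := hj
  exact ha
end

section
/- Let n ≥ 1 be an integer and let k be a natural number with k ≤ n+1. Let S_1, ..., S_{n+1} be exchangeable real-valued random variables. Then P( #{ i ∈ {1,...,n+1} : S_i ≥ S_{n+1} } ≤ k ) ≤ k/(n+1). -/
open MeasureTheory

open scoped Classical in
lemma rank_card_le {m : ℕ} (k : ℕ) (x : Fin m → ℝ) :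
    (Finset.univ.filter (fun j : Fin m =>
      (Finset.univ.filter (fun i : Fin m => x j ≤ x i)).card ≤ k)).card ≤ k := by
  set J := Finset.univ.filter (fun j : Fin m =>
      (Finset.univ.filter (fun i : Fin m => x j ≤ x i)).card ≤ k) with hJ
  rcases J.eq_empty_or_nonempty with h | h
  · simp [h]
  · obtain ⟨j, hj, hmin⟩ := J.exists_min_image x h
    have h1 : (Finset.univ.filter (fun i : Fin m => x j ≤ x i)).card ≤ k := by
      rw [hJ] at hj
      exact (Finset.mem_filter.1 hj).2
    refine le_trans (Finset.card_le_card ?_) h1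
    intro i hi
    exact Finset.mem_filter.2 ⟨Finset.mem_univ _, hmin i hi⟩

open scoped Classical in
lemma rank_measurableSet {m : ℕ} (k : ℕ) (j : Fin m) :
    MeasurableSet {x : Fin m → ℝ |
      (Finset.univ.filter (fun i : Fin m => x j ≤ x i)).card ≤ k} := by
  have h : Measurable (fun x : Fin m → ℝ =>
      (Finset.univ.filter (fun i : Fin m => x j ≤ x i)).card) := by
    simp only [Finset.card_filter]
    refine Finset.measurable_sum _ fun i _ => ?_
    exact Measurable.ite (measurableSet_le (measurable_pi_apply j) (measurable_pi_apply i))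
      measurable_const measurable_const
  exact h (measurableSet_Iic (a := k))

open scoped Classical in
/-- Scalar rank bound: for exchangeable scores `S_1, …, S_{n+1}`, the probability that
the test score `S_{n+1}` ranks among the top `k` (i.e., at most `k` of the `n+1`
scores are `≥ S_{n+1}`, including itself) is at most `k/(n+1)`. -/
theorem exchangeable_rank_bound
    (n : ℕ) (hn : 1 ≤ n) (k : ℕ) (hk : k ≤ n + 1)
    {Ω : Type*} [MeasurableSpace Ω] (P : Measure Ω) [IsProbabilityMeasure P]
    (S : Fin (n + 1) → Ω → ℝ)
    (hS : ∀ i, Measurable (S i))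
    (hexch : ∀ σ : Equiv.Perm (Fin (n + 1)),
      Measure.map (fun ω => fun i => S (σ i) ω) P
        = Measure.map (fun ω => fun i => S i ω) P) :
    P {ω | (Finset.univ.filter
        (fun i : Fin (n + 1) => S (Fin.last n) ω ≤ S i ω)).card ≤ k}
      ≤ (k : ENNReal) / (n + 1) := by
  set A : Fin (n + 1) → Set (Fin (n + 1) → ℝ) := fun j => {x |
      (Finset.univ.filter (fun i : Fin (n + 1) => x j ≤ x i)).card ≤ k} with hA
  have hAm : ∀ j, MeasurableSet (A j) := fun j => rank_measurableSet k j
  set ν := Measure.map (fun ω => fun i => S i ω) P with hν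
  have hSm : Measurable (fun ω => fun i => S i ω) := measurable_pi_lambda _ hS
  have : IsProbabilityMeasure ν := Measure.isProbabilityMeasure_map hSm.aemeasurable
  have hgoal : P {ω | (Finset.univ.filter
        (fun i : Fin (n + 1) => S (Fin.last n) ω ≤ S i ω)).card ≤ k} = ν (A (Fin.last n)) := by
    rw [hν, Measure.map_apply hSm (hAm _)]
    rfl
  have hsymm : ∀ j, ν (A j) = ν (A (Fin.last n)) := by
    intro j
    have hσ : Measurable (fun ω => fun i => S (Equiv.swap j (Fin.last n) i) ω) :=
      measurable_pi_lambda _ fun i => hS _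
    rw [← hexch (Equiv.swap j (Fin.last n)), Measure.map_apply hσ (hAm _), hexch, ← hgoal]
    congr 1
    ext ω
    simp only [hA, Set.mem_preimage, Set.mem_setOf_eq, Equiv.swap_apply_left]
    rw [← Finset.card_map (Equiv.swap j (Fin.last n)).toEmbedding]
    have : (Finset.univ.filter (fun i : Fin (n + 1) => S (Fin.last n) ω ≤
        S (Equiv.swap j (Fin.last n) i) ω)).map (Equiv.swap j (Fin.last n)).toEmbedding
        = Finset.univ.filter (fun i : Fin (n + 1) => S (Fin.last n) ω ≤ S i ω) := by
      ext i
      simp [Finset.mem_map_equiv]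
    rw [this]
  have hsum : ∑ j, ν (A j) ≤ k := by
    calc ∑ j, ν (A j) = ∑ j, ∫⁻ x, (A j).indicator 1 x ∂ν := by
          simp [lintegral_indicator_one (hAm _)]
      _ = ∫⁻ x, ∑ j, (A j).indicator 1 x ∂ν := by
          rw [lintegral_finsetSum]
          exact fun j _ => measurable_one.indicator (hAm j)
      _ ≤ ∫⁻ x, (k : ENNReal) ∂ν := by
          refine lintegral_mono fun x => ?_
          have := rank_card_le k x
          simp only [Set.indicator_apply, Pi.one_apply]
          rw [Finset.sum_boole]
          exact_mod_cast this
      _ = k := by simp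
  rw [hgoal, ENNReal.le_div_iff_mul_le (by simp) (by simp)]
  simp only [hsymm, Finset.sum_const, Finset.card_univ, Fintype.card_fin, nsmul_eq_mul] at hsum
  rw [mul_comm]
  exact_mod_cast hsum
end
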